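/- arXiv:math/0506455 — 2 statements merged into one kernel-verified Lean document; each statement's English description precedes it below -/
import Mathlib

section
/- In the exterior algebra Λ over a commutative ring R on generators e_1, e_2, …, with a fixed sequence w : {1,2,…} → R and Δ defined as below, let n ≥ 2 and let i_1 < i_2 < … < i_{n+1} be positive integers. Then the two Δ-elements overlapping in the single index i_2 multiply according to Δ(i_1, i_2) · Δ(i_2, i_3, …, i_{n+1}) = −w_{i_2} · Δ(i_1, i_2, …, i_{n+1}) in Λ. -/
/-- The exterior generator `e_i` of `Λ = Λ_R(e_i : i ≥ 1)`. -/
noncomputable def extGen {R : Type*} [CommRing R] (i : ℕ+) :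
    ExteriorAlgebra R (ℕ+ →₀ R) :=
  ExteriorAlgebra.ι R (Finsupp.single i 1)

/-- `Δ(i₁,…,i_m) = Σ_{k=1}^m (−1)^k w_{i_k} e_{i₁}⋯ê_{i_k}⋯e_{i_m}` (zero-based: `(−1)^(k+1)`). -/
noncomputable def Delta {R : Type*} [CommRing R] (w : ℕ+ → R) (l : List ℕ+) :
    ExteriorAlgebra R (ℕ+ →₀ R) :=
  ∑ k ∈ Finset.range l.length,
    ((-1 : ℤ) ^ (k + 1)) • (w (l.getD k 1) • ((l.eraseIdx k).map (extGen (R := R))).prod)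

theorem Delta_cons {R : Type*} [CommRing R] (w : ℕ+ → R) (a : ℕ+) (l : List ℕ+) :
    Delta w (a :: l) = -(w a • (l.map (extGen (R := R))).prod) - extGen a * Delta w l := by
  simp only [Delta, List.length_cons, Finset.sum_range_succ']
  simp [pow_succ, Finset.mul_sum, sub_eq_neg_add]
  refine Finset.sum_congr rfl fun k _ => ?_
  rw [← mul_assoc, ← mul_assoc, ((Commute.neg_one_left (extGen a)).pow_left k).eq]

theorem Delta_nil {R : Type*} [CommRing R] (w : ℕ+ → R) : Delta w [] = 0 := by
  simp [Delta]

theorem extGen_mul_self {R : Type*} [CommRing R] (i : ℕ+) :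
    extGen (R := R) i * extGen i = 0 :=
  ExteriorAlgebra.ι_sq_zero _

/-- The product formula for two `Δ`-elements overlapping in the index `b`. -/
theorem Delta_pair_mul_Delta_cons {R : Type*} [CommRing R] (w : ℕ+ → R) (a b : ℕ+)
    (l : List ℕ+) :
    Delta w [a, b] * Delta w (b :: l) = -(w b • Delta w (a :: b :: l)) := by
  have h (x : ExteriorAlgebra R (ℕ+ →₀ R)) : extGen b * (extGen b * x) = 0 := by
    rw [← mul_assoc, extGen_mul_self, zero_mul]
  simp only [Delta_cons, Delta_nil, List.map_cons, List.map_nil, List.prod_cons, List.prod_nil,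
    mul_one, mul_zero, sub_zero, mul_sub, sub_mul, mul_neg, neg_mul, smul_sub, smul_neg,
    smul_mul_assoc, mul_smul_comm, h, smul_zero, smul_comm (w b) (w a)]
  abel

/-- For `n ≥ 2` and `i₁ < i₂ < … < i_{n+1}` (given by a strictly monotone
`f : Fin (n+1) → ℕ+`), the overlapping product formula
`Δ(i₁,i₂) · Δ(i₂,…,i_{n+1}) = −w_{i₂} · Δ(i₁,…,i_{n+1})`. -/
theorem stmt9 {R : Type*} [CommRing R] (w : ℕ+ → R) (n : ℕ) (hn : 2 ≤ n)
    (f : Fin (n + 1) → ℕ+) (hf : StrictMono f) :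
    Delta w [f 0, f 1] * Delta w (List.ofFn fun k : Fin n => f k.succ) =
      - (w (f 1) • Delta w (List.ofFn f)) := by
  obtain ⟨m, rfl⟩ : ∃ m, n = m + 1 := ⟨n - 1, by omega⟩
  simp only [List.ofFn_succ]
  exact Delta_pair_mul_Delta_cons w (f 0) (f 1) _
end

section
/- Let R be a commutative ring, x ∈ R a nonzerodivisor which is not a unit, and w_1, w_2, … a sequence in R which is regular in R and whose reduction is regular in R/(x), and let (K', d') be the generalized Koszul complex with d'(e_I) = Σ_k (−1)^{k−1}·x·w_{i_k}·e_{I minus i_k} as defined below, with Δ(I) := Σ_{k=1}^{n+1} (−1)^k·w_{i_k}·e_{(i_1,…,î_k,…,i_{n+1})} ∈ K'_n for each strictly increasing (n+1)-tuple I. Then: (a) the zeroth homology of K' is R/(x·w_r : r ≥ 1); and (b) for every n ≥ 1, writing w̄ for images in R/(x), the R/(x)-linear map from F_n/N_n to H_n(K') = ker(d'_n)/im(d'_{n+1}) sending the class of the basis element [I] to the homology class of Δ(I) is a well-defined isomorphism of R/(x)-modules, where F_n is the free R/(x)-module on the strictly increasing (n+1)-tuples of positive integers and N_n ⊆ F_n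 is the submodule generated, for each strictly increasing (n+2)-tuple (i_1 < … < i_{n+2}), by the element Σ_{j=1}^{n+2} (−1)^j·w̄_{i_j}·[(i_1,…,î_j,…,i_{n+2})]. (The R-module structure on H_n(K') for n ≥ 1 factors through R/(x) since x annihilates H_n(K').) -/
/-- The generalized Koszul complex `Λ_R(e'_r : r ≥ 1)` with `d'(e'_r) = x·w_r`, on its
canonical basis; `koszulD w'` with `w' = fun i => x * w i` gives `d'`. -/
noncomputable def koszulD {R : Type*} [CommRing R] (w : ℕ+ → R) (n : ℕ) :
    ({f : Fin (n + 1) → ℕ+ // StrictMono f} →₀ R) →ₗ[R]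
      ({f : Fin n → ℕ+ // StrictMono f} →₀ R) :=
  Finsupp.lsum R fun I =>
    LinearMap.smulRight (LinearMap.id : R →ₗ[R] R)
      (∑ k : Fin (n + 1),
        Finsupp.single ⟨I.1 ∘ k.succAbove, I.2.comp (Fin.strictMono_succAbove k)⟩
          ((-1 : R) ^ (k : ℕ) * w (I.1 k)))

/-- `Δ(I) = Σ_{k=1}^{n+1} (−1)^k w_{i_k} e_{(i₁,…,î_k,…,i_{n+1})} ∈ K'_n` for a strictly
increasing `(n+1)`-tuple `I` (zero-based sign `(−1)^(k+1)`). -/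
noncomputable def DeltaK {R : Type*} [CommRing R] (w : ℕ+ → R) (n : ℕ)
    (I : {f : Fin (n + 1) → ℕ+ // StrictMono f}) :
    {f : Fin n → ℕ+ // StrictMono f} →₀ R :=
  ∑ k : Fin (n + 1),
    Finsupp.single ⟨I.1 ∘ k.succAbove, I.2.comp (Fin.strictMono_succAbove k)⟩
      ((-1 : R) ^ ((k : ℕ) + 1) * w (I.1 k))

/-- Strictly increasing `n`-tuples of positive integers, indexing the basis in degree `n`. -/
abbrev KoszulIndex (n : ℕ) : Type := {f : Fin n → ℕ+ // StrictMono f}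

namespace KoszulIndex

variable {n : ℕ}

/-- Omit the `k`-th entry. -/
def face (I : KoszulIndex (n + 1)) (k : Fin (n + 1)) : KoszulIndex n :=
  ⟨I.1 ∘ k.succAbove, I.2.comp (Fin.strictMono_succAbove k)⟩

/-- Tuples all of whose entries are less than `m`. -/
def below (n : ℕ) (m : ℕ+) : Set (KoszulIndex n) := {I | ∀ k, I.1 k < m}

theorem face_mem_below {m : ℕ+} {I : KoszulIndex (n + 1)} (hI : I ∈ below (n + 1) m)
    (k : Fin (n + 1)) : I.face k ∈ below n m :=
  fun _ => hI _

/-- Append the entry `m` to a tuple with entries less than `m`. -/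
def snoc (I : KoszulIndex n) (m : ℕ+) (hI : I ∈ below n m) : KoszulIndex (n + 1) :=
  ⟨Fin.snoc (α := fun _ => ℕ+) I.1 m, by
    intro a b hab
    induction b using Fin.lastCases with
    | last =>
      induction a using Fin.lastCases with
      | last => exact absurd hab (lt_irrefl _)
      | cast a => simpa using hI a
    | cast b =>
      induction a using Fin.lastCases with
      | last => exact absurd hab (not_lt.2 (Fin.le_last _))
      | cast a => simpa using I.2 (by simpa using hab)⟩

theorem snoc_last (I : KoszulIndex n) (m : ℕ+) (hI : I ∈ below n m) :
    (I.snoc m hI).1 (Fin.last n) = m := by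
  simp [snoc]

theorem snoc_castSucc (I : KoszulIndex n) (m : ℕ+) (hI : I ∈ below n m) (k : Fin n) :
    (I.snoc m hI).1 k.castSucc = I.1 k := by
  simp [snoc]

theorem face_last_snoc (I : KoszulIndex n) (m : ℕ+) (hI : I ∈ below n m) :
    (I.snoc m hI).face (Fin.last n) = I := by
  ext k
  simp [face, snoc]

theorem face_castSucc_snoc (I : KoszulIndex (n + 1)) (m : ℕ+) (hI : I ∈ below (n + 1) m)
    (k : Fin (n + 1)) :
    (I.snoc m hI).face k.castSucc = (I.face k).snoc m (face_mem_below hI k) := by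
  ext j
  induction j using Fin.lastCases with
  | last => simp [face, snoc]
  | cast j =>
    simp only [face, snoc, Function.comp_apply, Fin.castSucc_succAbove_castSucc,
      Fin.snoc_castSucc]

theorem face_last_mem_below (I : KoszulIndex (n + 1)) :
    I.face (Fin.last n) ∈ below n (I.1 (Fin.last n)) :=
  fun k => I.2 (by simp [Fin.castSucc_lt_last])

theorem snoc_face_last (I : KoszulIndex (n + 1)) :
    (I.face (Fin.last n)).snoc (I.1 (Fin.last n)) I.face_last_mem_below = I := by
  ext j
  induction j using Fin.lastCases with
  | last => simp [snoc]
  | cast j => simp [face, snoc]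

theorem mem_below_iff (I : KoszulIndex (n + 1)) (m : ℕ+) :
    I ∈ below (n + 1) m ↔ I.1 (Fin.last n) < m :=
  ⟨fun h => h _, fun h k => (I.2.monotone (Fin.le_last k)).trans_lt h⟩

end KoszulIndex

section Koszul

open KoszulIndex

variable {R : Type*} [CommRing R] (w : ℕ+ → R)

theorem koszulD_single (n : ℕ) (I : KoszulIndex (n + 1)) :
    koszulD w n (Finsupp.single I 1) =
      ∑ k : Fin (n + 1), ((-1 : R) ^ (k : ℕ) * w (I.1 k)) • Finsupp.single (I.face k) 1 := by
  simp [koszulD, face]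

theorem koszulD_mul_left (x : R) (n : ℕ) : koszulD (fun i => x * w i) n = x • koszulD w n := by
  refine Finsupp.lhom_ext' fun I => LinearMap.ext_ring ?_
  simp only [LinearMap.comp_apply, Finsupp.lsingle_apply, LinearMap.smul_apply, koszulD_single,
    Finset.smul_sum, smul_smul]
  exact Finset.sum_congr rfl fun k _ => by rw [mul_left_comm]

theorem DeltaK_eq_neg_koszulD (n : ℕ) (I : KoszulIndex (n + 1)) :
    DeltaK w n I = -koszulD w n (Finsupp.single I 1) := by
  rw [koszulD_single, ← Finset.sum_neg_distrib]
  exact Finset.sum_congr rfl fun k _ => by simp [face, pow_succ]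

theorem LinearMap.range_eq_span_single {α M : Type*} [AddCommGroup M] [Module R M]
    (f : (α →₀ R) →ₗ[R] M) :
    LinearMap.range f = Submodule.span R (Set.range fun a => f (Finsupp.single a 1)) := by
  rw [LinearMap.range_eq_map, ← (Finsupp.basisSingleOne (R := R) (ι := α)).span_eq,
    Submodule.map_span, ← Set.range_comp]
  simp [Function.comp_def]

/-- Chains of degree `n` supported on tuples with entries less than `m`. -/
abbrev koszulBelow (R : Type*) [CommRing R] (n : ℕ) (m : ℕ+) :
    Submodule R (KoszulIndex n →₀ R) :=
  Finsupp.supported R R (below n m)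

theorem single_mem_koszulBelow {n : ℕ} {m : ℕ+} {I : KoszulIndex n} (hI : I ∈ below n m) :
    Finsupp.single I (1 : R) ∈ koszulBelow R n m :=
  Finsupp.single_mem_supported R _ hI

theorem koszulBelow_le_iff {n : ℕ} {m : ℕ+} {p : Submodule R (KoszulIndex n →₀ R)} :
    koszulBelow R n m ≤ p ↔ ∀ I ∈ below n m, Finsupp.single I 1 ∈ p := by
  rw [koszulBelow, Finsupp.supported_eq_span_single, Submodule.span_le, Set.image_subset_iff]
  rfl

theorem koszulD_mem_koszulBelow {n : ℕ} {m : ℕ+} {v : KoszulIndex (n + 1) →₀ R}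
    (hv : v ∈ koszulBelow R (n + 1) m) : koszulD w n v ∈ koszulBelow R n m := by
  suffices h : koszulBelow R (n + 1) m ≤ (koszulBelow R n m).comap (koszulD w n) from h hv
  rw [koszulBelow_le_iff]
  intro I hI
  rw [Submodule.mem_comap, koszulD_single]
  exact sum_mem fun k _ =>
    Submodule.smul_mem _ _ (single_mem_koszulBelow (face_mem_below hI k))

open Classical in
/-- Right exterior multiplication by `e_m` on chains with entries less than `m`. -/
noncomputable def koszulWedge (R : Type*) [CommRing R] (n : ℕ) (m : ℕ+) :
    (KoszulIndex n →₀ R) →ₗ[R] (KoszulIndex (n + 1) →₀ R) :=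
  Finsupp.linearCombination R fun I =>
    if hI : I ∈ below n m then Finsupp.single (I.snoc m hI) 1 else 0

theorem koszulWedge_single {n : ℕ} {m : ℕ+} {I : KoszulIndex n} (hI : I ∈ below n m) :
    koszulWedge R n m (Finsupp.single I 1) = Finsupp.single (I.snoc m hI) 1 := by
  simp [koszulWedge, hI]

/-- The coefficient of `e_m` as last factor. -/
noncomputable def koszulCoeff (R : Type*) [CommRing R] (n : ℕ) (m : ℕ+) :
    (KoszulIndex (n + 1) →₀ R) →ₗ[R] (KoszulIndex n →₀ R) :=
  Finsupp.linearCombination R fun I =>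
    if I.1 (Fin.last n) = m then Finsupp.single (I.face (Fin.last n)) 1 else 0

theorem koszulCoeff_eq_zero {n : ℕ} {m : ℕ+} {v : KoszulIndex (n + 1) →₀ R}
    (hv : v ∈ koszulBelow R (n + 1) m) : koszulCoeff R n m v = 0 := by
  suffices h : koszulBelow R (n + 1) m ≤ LinearMap.ker (koszulCoeff R n m) from h hv
  rw [koszulBelow_le_iff]
  intro I hI
  simp [koszulCoeff, (hI (Fin.last n)).ne]

theorem koszulCoeff_koszulWedge {n : ℕ} {m : ℕ+} {v : KoszulIndex n →₀ R}
    (hv : v ∈ koszulBelow R n m) : koszulCoeff R n m (koszulWedge R n m v) = v := by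
  suffices h : koszulBelow R n m ≤
      LinearMap.eqLocus (koszulCoeff R n m ∘ₗ koszulWedge R n m) LinearMap.id from h hv
  rw [koszulBelow_le_iff]
  intro I hI
  simp [LinearMap.mem_eqLocus, koszulWedge_single hI, koszulCoeff, snoc_last, face_last_snoc]

theorem koszulD_koszulWedge_zero {m : ℕ+} {v : KoszulIndex 0 →₀ R}
    (hv : v ∈ koszulBelow R 0 m) : koszulD w 0 (koszulWedge R 0 m v) = w m • v := by
  suffices h : koszulBelow R 0 m ≤
      LinearMap.eqLocus (koszulD w 0 ∘ₗ koszulWedge R 0 m) (w m • LinearMap.id) from h hv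
  rw [koszulBelow_le_iff]
  intro I hI
  have h := face_last_snoc I m hI
  have h' := snoc_last I m hI
  simp only [Fin.last_zero] at h h'
  simp [LinearMap.mem_eqLocus, koszulWedge_single hI, koszulD_single, h, h']

theorem koszulD_koszulWedge_succ {n : ℕ} {m : ℕ+} {v : KoszulIndex (n + 1) →₀ R}
    (hv : v ∈ koszulBelow R (n + 1) m) :
    koszulD w (n + 1) (koszulWedge R (n + 1) m v) =
      koszulWedge R n m (koszulD w n v) + ((-1) ^ (n + 1) * w m) • v := by
  suffices h : koszulBelow R (n + 1) m ≤
      LinearMap.eqLocus (koszulD w (n + 1) ∘ₗ koszulWedge R (n + 1) m)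
        (koszulWedge R n m ∘ₗ koszulD w n + ((-1) ^ (n + 1) * w m) • LinearMap.id) from h hv
  rw [koszulBelow_le_iff]
  intro I hI
  simp only [LinearMap.mem_eqLocus, LinearMap.comp_apply, LinearMap.add_apply,
    LinearMap.smul_apply, LinearMap.id_apply, koszulWedge_single hI, koszulD_single]
  rw [Fin.sum_univ_castSucc, map_sum]
  congr 1
  · refine Finset.sum_congr rfl fun k _ => ?_
    rw [map_smul, koszulWedge_single (face_mem_below hI k), face_castSucc_snoc, snoc_castSucc,
      Fin.val_castSucc]
  · rw [face_last_snoc, snoc_last, Fin.val_last]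

theorem koszulD_comp_koszulD (n : ℕ) : koszulD w n ∘ₗ koszulD w (n + 1) = 0 := by
  induction n with
  | zero =>
    refine Finsupp.lhom_ext' fun I => LinearMap.ext_ring ?_
    have hI := single_mem_koszulBelow (R := R) (face_last_mem_below I)
    simp only [LinearMap.comp_apply, Finsupp.lsingle_apply, LinearMap.zero_apply]
    rw [← snoc_face_last I, ← koszulWedge_single (face_last_mem_below I),
      koszulD_koszulWedge_succ w hI, map_add, map_smul,
      koszulD_koszulWedge_zero w (koszulD_mem_koszulBelow w hI), ← add_smul]
    simp
  | succ n ih =>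
    refine Finsupp.lhom_ext' fun I => LinearMap.ext_ring ?_
    have hI := single_mem_koszulBelow (R := R) (face_last_mem_below I)
    simp only [LinearMap.comp_apply, Finsupp.lsingle_apply, LinearMap.zero_apply]
    rw [← snoc_face_last I, ← koszulWedge_single (face_last_mem_below I),
      koszulD_koszulWedge_succ w hI, map_add, map_smul,
      koszulD_koszulWedge_succ w (koszulD_mem_koszulBelow w hI), ← LinearMap.comp_apply
        (koszulD w n), ih, LinearMap.zero_apply, map_zero, zero_add, ← add_smul, pow_succ _ (n + 1)]
    simp

theorem koszulBelow_add_one_le (n : ℕ) (m : ℕ+) :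
    koszulBelow R (n + 1) (m + 1) ≤
      koszulBelow R (n + 1) m ⊔ (koszulBelow R n m).map (koszulWedge R n m) := by
  rw [koszulBelow_le_iff]
  intro I hI
  rw [mem_below_iff, PNat.lt_add_one_iff] at hI
  obtain hI | rfl := hI.lt_or_eq
  · exact Submodule.mem_sup_left (single_mem_koszulBelow ((mem_below_iff I m).2 hI))
  · refine Submodule.mem_sup_right ⟨_, single_mem_koszulBelow (face_last_mem_below I), ?_⟩
    rw [koszulWedge_single (face_last_mem_below I), snoc_face_last]

instance : Unique (KoszulIndex 0) where
  default := ⟨Fin.elim0, fun a => a.elim0⟩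
  uniq _ := Subtype.ext (funext fun a => a.elim0)

/-- The identification of `R` with the degree zero part, sending `1` to `e_∅`. -/
noncomputable def koszulZeroEquiv (R : Type*) [CommRing R] : R ≃ₗ[R] (KoszulIndex 0 →₀ R) :=
  (Finsupp.uniqueLinearEquiv R R default).symm

theorem koszulZeroEquiv_apply (r : R) : koszulZeroEquiv R r = Finsupp.single default r := rfl

theorem map_koszulD_zero_supported (S : Set ℕ+) :
    (Finsupp.supported R R {I : KoszulIndex 1 | I.1 0 ∈ S}).map (koszulD w 0) =
      Submodule.map (koszulZeroEquiv R).toLinearMap (Ideal.span (w '' S)) := by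
  have hd : ∀ I : KoszulIndex 1,
      koszulD w 0 (Finsupp.single I 1) = koszulZeroEquiv R (w (I.1 0)) := fun I => by
    simp [koszulD_single, koszulZeroEquiv_apply, Unique.eq_default (I.face 0)]
  rw [Finsupp.supported_eq_span_single, Submodule.map_span, Ideal.span, Submodule.map_span]
  congr 1
  ext y
  constructor
  · rintro ⟨_, ⟨I, hI, rfl⟩, rfl⟩
    exact ⟨_, ⟨_, hI, rfl⟩, (hd I).symm⟩
  · rintro ⟨_, ⟨i, hi, rfl⟩, rfl⟩
    let I : KoszulIndex 1 := ⟨fun _ => i, fun a b hab => absurd (Subsingleton.elim a b) hab.ne⟩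
    exact ⟨_, ⟨I, hi, rfl⟩, hd I⟩

variable {w}

theorem mem_map_koszulD_of_smul_mem {m : ℕ+}
    (hreg : ∀ r : R, r * w m ∈ Ideal.span (w '' Set.Iio m) → r ∈ Ideal.span (w '' Set.Iio m))
    {b : KoszulIndex 0 →₀ R} (hb : w m • b ∈ (koszulBelow R 1 m).map (koszulD w 0)) :
    b ∈ (koszulBelow R 1 m).map (koszulD w 0) := by
  have hS : below 1 m = {I : KoszulIndex 1 | I.1 0 ∈ Set.Iio m} := by
    ext I
    simp [mem_below_iff]
  simp only [koszulBelow, hS, map_koszulD_zero_supported, Submodule.mem_map_equiv] at hb ⊢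
  refine hreg _ ?_
  rwa [map_smul, smul_eq_mul, mul_comm] at hb

theorem koszulBelow_inf_ker_le
    (hreg : ∀ m : ℕ+, ∀ r : R,
      r * w m ∈ Ideal.span (w '' Set.Iio m) → r ∈ Ideal.span (w '' Set.Iio m))
    (m : ℕ+) (n : ℕ) {v : KoszulIndex (n + 1) →₀ R} (hv : v ∈ koszulBelow R (n + 1) m)
    (hdv : koszulD w n v = 0) :
    v ∈ (koszulBelow R (n + 2) m).map (koszulD w (n + 1)) := by
  induction m using PNat.recOn generalizing n v with
  | one =>
    have h : below (n + 1) 1 = ∅ :=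
      Set.eq_empty_of_forall_notMem fun I hI => not_lt_one (hI 0)
    rw [koszulBelow, h, Finsupp.supported_empty, Submodule.mem_bot] at hv
    rw [hv]
    exact zero_mem _
  | succ m ih =>
    have hmono : ∀ {k : ℕ} {u : KoszulIndex k →₀ R}, u ∈ koszulBelow R k m →
        u ∈ koszulBelow R k (m + 1) := fun hu =>
      Finsupp.supported_mono (fun I hI k => (hI k).trans (PNat.lt_add_right m 1)) hu
    have hwedge : ∀ {k : ℕ} {u : KoszulIndex k →₀ R}, u ∈ koszulBelow R k m →
        koszulWedge R k m u ∈ koszulBelow R (k + 1) (m + 1) := by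
      intro k u hu
      suffices h : koszulBelow R k m ≤
        (koszulBelow R (k + 1) (m + 1)).comap (koszulWedge R k m) from h hu
      rw [koszulBelow_le_iff]
      intro I hI
      rw [Submodule.mem_comap, koszulWedge_single hI]
      refine single_mem_koszulBelow ((mem_below_iff _ _).2 ?_)
      rw [snoc_last]
      exact PNat.lt_add_right m 1
    obtain ⟨a, ha, _, ⟨b, hb, rfl⟩, rfl⟩ :=
      Submodule.mem_sup.1 (koszulBelow_add_one_le n m hv)
    obtain ⟨c, hc, rfl⟩ : b ∈ (koszulBelow R (n + 1) m).map (koszulD w n) := by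
      cases n with
      | zero =>
        rw [map_add, koszulD_koszulWedge_zero w hb] at hdv
        refine mem_map_koszulD_of_smul_mem (hreg m) ?_
        rw [← neg_eq_of_add_eq_zero_right hdv]
        exact neg_mem (Submodule.mem_map_of_mem ha)
      | succ n =>
        refine ih n hb ?_
        rw [map_add, koszulD_koszulWedge_succ w hb] at hdv
        have h := congrArg (koszulCoeff R n m) hdv
        rwa [map_add, map_add, koszulCoeff_eq_zero (koszulD_mem_koszulBelow w ha),
          koszulCoeff_koszulWedge (koszulD_mem_koszulBelow w hb),
          koszulCoeff_eq_zero (Submodule.smul_mem _ _ hb), map_zero, zero_add, add_zero] at h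
    have hdd : ∀ u, koszulD w n (koszulD w (n + 1) u) = 0 := fun u =>
      LinearMap.congr_fun (koszulD_comp_koszulD w n) u
    have hd := koszulD_koszulWedge_succ w hc
    have hcycle : koszulD w n (a - ((-1) ^ (n + 1) * w m) • c) = 0 := by
      have h : a - ((-1) ^ (n + 1) * w m) • c =
          a + koszulWedge R n m (koszulD w n c) -
            koszulD w (n + 1) (koszulWedge R (n + 1) m c) := by
        rw [hd]
        abel
      rw [h, map_sub, hdv, hdd, sub_zero]
    obtain ⟨c', hc', hdc'⟩ := ih n (sub_mem ha (Submodule.smul_mem _ _ hc)) hcycle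
    refine ⟨c' + koszulWedge R (n + 1) m c, add_mem (hmono hc') (hwedge hc), ?_⟩
    rw [map_add, hdc', hd]
    abel

theorem ker_koszulD_eq_range
    (hreg : ∀ m : ℕ+, ∀ r : R,
      r * w m ∈ Ideal.span (w '' Set.Iio m) → r ∈ Ideal.span (w '' Set.Iio m)) (n : ℕ) :
    LinearMap.ker (koszulD w n) = LinearMap.range (koszulD w (n + 1)) := by
  refine le_antisymm (fun v hv => ?_) (LinearMap.range_le_ker_iff.2 (koszulD_comp_koszulD w n))
  obtain ⟨m, hm⟩ := (v.support.image fun I => I.1 (Fin.last n)).exists_le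
  have hv' : v ∈ koszulBelow R (n + 1) (m + 1) := fun I hI =>
    (mem_below_iff I _).2 (PNat.lt_add_one_iff.2 (hm _ (Finset.mem_image_of_mem _ hI)))
  exact LinearMap.map_le_range (koszulBelow_inf_ker_le hreg _ n hv' hv)

end Koszul

/-- Theorem (GenKosComp-Homology): (a) `H₀(K') = R/(x·w_r : r ≥ 1)`; (b) for `n ≥ 1`
(internally: homology in degree `n+1` for `n : ℕ`), `H_n(K')` is the quotient of the free
module on strictly increasing `(n+1)`-tuples `I` — with `x·e_I` killed, so a free
`R/(x)`-module — by the relations `Σ_j (−1)^j w_{i_j} [J minus i_j]` for `(n+2)`-tuples `J`,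
the class of `[I]` mapping to the homology class of `Δ(I)`. -/
theorem stmt12 {R : Type*} [CommRing R] (x : R) (hx : x ∈ nonZeroDivisors R)
    (hxu : ¬ IsUnit x) (w : ℕ+ → R)
    (hreg : ∀ m : ℕ+, ∀ r : R,
      r * w m ∈ Ideal.span {y | ∃ k : ℕ+, k < m ∧ y = w k} →
        r ∈ Ideal.span {y | ∃ k : ℕ+, k < m ∧ y = w k})
    (hregx : ∀ m : ℕ+, ∀ r : R,
      r * w m ∈ Ideal.span ({x} ∪ {y | ∃ k : ℕ+, k < m ∧ y = w k}) →
        r ∈ Ideal.span ({x} ∪ {y | ∃ k : ℕ+, k < m ∧ y = w k})) :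
    -- (a) the zeroth homology is `R/(x w_r : r ≥ 1)`
    (∃ g : (R ⧸ Ideal.span {y | ∃ i : ℕ+, y = x * w i}) →ₗ[R]
        (({f : Fin 0 → ℕ+ // StrictMono f} →₀ R) ⧸
          LinearMap.range (koszulD (fun i => x * w i) 0)),
      Function.Bijective g ∧
      ∀ r : R, g (Ideal.Quotient.mk (Ideal.span {y | ∃ i : ℕ+, y = x * w i}) r) =
        Submodule.Quotient.mk
          (Finsupp.single (⟨Fin.elim0, by intro a; exact a.elim0⟩ :
            {f : Fin 0 → ℕ+ // StrictMono f}) r)) ∧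
    -- (b) for each `n`, the homology in degree `n + 1`: the induced map from
    -- `F/N` onto `ker d'/im d'` (realized inside `K'_{n+1}/im d'`) is an isomorphism
    ∀ n : ℕ,
      (∀ I : {f : Fin (n + 2) → ℕ+ // StrictMono f},
        DeltaK w (n + 1) I ∈ LinearMap.ker (koszulD (fun i => x * w i) n)) ∧
      ∃ g : (({f : Fin (n + 2) → ℕ+ // StrictMono f} →₀ R) ⧸
          Submodule.span R
            ((Set.range fun I : {f : Fin (n + 2) → ℕ+ // StrictMono f} =>
                Finsupp.single I x) ∪
              Set.range (DeltaK w (n + 2)))) →ₗ[R]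
        (({f : Fin (n + 1) → ℕ+ // StrictMono f} →₀ R) ⧸
          LinearMap.range (koszulD (fun i => x * w i) (n + 1))),
        Function.Injective g ∧
        LinearMap.range g =
          Submodule.map
            (Submodule.mkQ (LinearMap.range (koszulD (fun i => x * w i) (n + 1))))
            (LinearMap.ker (koszulD (fun i => x * w i) n)) ∧
        ∀ I : {f : Fin (n + 2) → ℕ+ // StrictMono f},
          g (Submodule.Quotient.mk (Finsupp.single I 1)) =
            Submodule.Quotient.mk (DeltaK w (n + 1) I) := by
  have hset : ∀ m : ℕ+, {y | ∃ k : ℕ+, k < m ∧ y = w k} = w '' Set.Iio m := fun m => by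
    ext y
    simp [eq_comm]
  simp only [hset] at hreg
  have hxinj : ∀ {n : ℕ} {v : KoszulIndex n →₀ R}, x • v = 0 → v = 0 := fun {n v} h =>
    Finsupp.ext fun I => by
      have h' : x * v I = 0 := by simpa using DFunLike.congr_fun h I
      simpa using (mem_nonZeroDivisors_iff.1 hx).1 _ h'
  have hker : ∀ n, LinearMap.ker (koszulD (fun i => x * w i) n) =
      LinearMap.range (koszulD w (n + 1)) := fun n => by
    rw [← ker_koszulD_eq_range hreg, koszulD_mul_left]
    ext v
    exact ⟨fun h => hxinj h, fun h => by
      rw [LinearMap.mem_ker] at h ⊢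
      rw [LinearMap.smul_apply, h, smul_zero]⟩
  refine ⟨?_, fun n => ⟨fun I => ?_, ?_⟩⟩
  · have he : Submodule.map (koszulZeroEquiv R).toLinearMap
        (Ideal.span {y | ∃ i : ℕ+, y = x * w i}) =
          LinearMap.range (koszulD (fun i => x * w i) 0) := by
      have hS : {y | ∃ i : ℕ+, y = x * w i} = (fun i => x * w i) '' Set.univ := by
        ext y
        simp [eq_comm]
      rw [hS, ← map_koszulD_zero_supported, LinearMap.range_eq_map]
      simp [Finsupp.supported_univ]
    let g := Submodule.Quotient.equiv _ _ (koszulZeroEquiv R) he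
    exact ⟨g.toLinearMap, g.bijective, fun r => rfl⟩
  · rw [hker, DeltaK_eq_neg_koszulD]
    exact neg_mem (LinearMap.mem_range_self _ _)
  · let f := (LinearMap.range (koszulD (fun i => x * w i) (n + 1))).mkQ ∘ₗ (-koszulD w (n + 1))
    have hN : Submodule.span R
        ((Set.range fun I : KoszulIndex (n + 2) => Finsupp.single I x) ∪
          Set.range (DeltaK w (n + 2))) = LinearMap.ker f := by
      have h₁ := LinearMap.range_eq_span_single
        (x • LinearMap.id : (KoszulIndex (n + 2) →₀ R) →ₗ[R] _)
      have h₂ := LinearMap.range_eq_span_single (-koszulD w (n + 2))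
      simp only [LinearMap.smul_apply, LinearMap.id_apply, Finsupp.smul_single, smul_eq_mul,
        mul_one, LinearMap.neg_apply, ← DeltaK_eq_neg_koszulD] at h₁ h₂
      rw [Submodule.span_union, ← h₁, ← h₂, LinearMap.range_neg, ← ker_koszulD_eq_range hreg]
      ext v
      simp only [f, LinearMap.ker_comp, Submodule.ker_mkQ, Submodule.mem_comap,
        LinearMap.neg_apply, neg_mem_iff, koszulD_mul_left, Submodule.mem_sup]
      constructor
      · rintro ⟨_, ⟨u, rfl⟩, c, hc, rfl⟩
        refine ⟨u, ?_⟩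
        rw [map_add, LinearMap.mem_ker.1 hc]
        simp
      · rintro ⟨u, hu⟩
        refine ⟨x • u, ⟨u, rfl⟩, v - x • u, ?_, by abel⟩
        rw [LinearMap.mem_ker, map_sub, ← hu]
        simp
    refine ⟨Submodule.liftQ _ f hN.le, ?_, ?_, fun I => ?_⟩
    · exact LinearMap.ker_eq_bot.1 (Submodule.ker_liftQ_eq_bot _ _ _ hN.ge)
    · rw [Submodule.range_liftQ, LinearMap.range_comp, LinearMap.range_neg, hker]
    · rw [DeltaK_eq_neg_koszulD]
      rfl
end
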